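/- Let p₁ := ξ₂ + ξ₃ + ξ₄, p₂ := ξ₂ξ₃ + ξ₂ξ₄ + ξ₃ξ₄ and p₃ := ξ₂ξ₃ξ₄ be the elementary symmetric functions of ξ₂, ξ₃, ξ₄. Then at every point of ℍ: p₂ − (1/3)·p₁² = −(1/48)·E4 and p₃ − (1/3)·p₁·p₂ + (2/27)·p₁³ = (1/864)·E6. -/

import Mathlib

open Complex

noncomputable section

/-- `q = e^{2πiτ}`. -/
def qexp (τ : ℂ) : ℂ := Complex.exp (2 * ↑Real.pi * Complex.I * τ)

/-- `q^s = e^{2πisτ}` for real `s`. -/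
def qpow (s : ℝ) (τ : ℂ) : ℂ := Complex.exp (2 * ↑Real.pi * Complex.I * ↑s * τ)

/-- The differential operator `f' = (1/(2πi)) df/dτ` (i.e. `q d/dq`). -/
def Dq (f : ℂ → ℂ) : ℂ → ℂ := fun τ => deriv f τ / (2 * ↑Real.pi * Complex.I)

/-- The divisor power sum `σ_k(n)`. -/
def sigma' (k n : ℕ) : ℕ := ∑ d ∈ n.divisors, d ^ k

/-- The quasimodular Eisenstein series `E₂`. -/
def E2 (τ : ℂ) : ℂ := 1 - 24 * ∑' n : ℕ, (sigma' 1 (n + 1) : ℂ) * qexp τ ^ (n + 1)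

/-- The Eisenstein series `E₄`. -/
def E4 (τ : ℂ) : ℂ := 1 + 240 * ∑' n : ℕ, (sigma' 3 (n + 1) : ℂ) * qexp τ ^ (n + 1)

/-- The Eisenstein series `E₆`. -/
def E6 (τ : ℂ) : ℂ := 1 - 504 * ∑' n : ℕ, (sigma' 5 (n + 1) : ℂ) * qexp τ ^ (n + 1)

/-- The Dedekind eta function `η(τ) = q^{1/24} ∏ (1 - qⁿ)`. -/
def η (τ : ℂ) : ℂ := qpow (1/24) τ * ∏' n : ℕ, (1 - qexp τ ^ (n + 1))

/-- Theta constant `θ₂(τ) = Σ_{n∈ℤ} q^{(n-1/2)²/2}`. -/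
def θ₂ (τ : ℂ) : ℂ := ∑' n : ℤ, qpow (((n : ℝ) - 1/2) ^ 2 / 2) τ

/-- Theta constant `θ₃(τ) = Σ_{n∈ℤ} q^{n²/2}`. -/
def θ₃ (τ : ℂ) : ℂ := ∑' n : ℤ, qpow ((n : ℝ) ^ 2 / 2) τ

/-- Theta constant `θ₄(τ) = Σ_{n∈ℤ} (-1)ⁿ q^{n²/2}`. -/
def θ₄ (τ : ℂ) : ℂ := ∑' n : ℤ, (-1 : ℂ) ^ n * qpow ((n : ℝ) ^ 2 / 2) τ

/-- `ξ₂ = 2 θ₂'/θ₂`. -/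
def ξ₂ : ℂ → ℂ := fun τ => 2 * Dq θ₂ τ / θ₂ τ

/-- `ξ₃ = 2 θ₃'/θ₃`. -/
def ξ₃ : ℂ → ℂ := fun τ => 2 * Dq θ₃ τ / θ₃ τ

/-- `ξ₄ = 2 θ₄'/θ₄`. -/
def ξ₄ : ℂ → ℂ := fun τ => 2 * Dq θ₄ τ / θ₄ τ

/-- `h₀ = 4ξ₂ - 2ξ₃ - 2ξ₄` (equal to `η⁴ χ_{Λ₀}^{q}`). -/
def h₀ : ℂ → ℂ := fun τ => 4 * ξ₂ τ - 2 * ξ₃ τ - 2 * ξ₄ τ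

/-- `h₁ = 2ξ₃ - 2ξ₄` (equal to `η⁴ χ_{Λ₁}^{q}`). -/
def h₁ : ℂ → ℂ := fun τ => 2 * ξ₃ τ - 2 * ξ₄ τ

/-- The Serre-type derivative `∂_k f = f' - (k/12) E₂ f`. -/
def partialD (k : ℂ) (f : ℂ → ℂ) : ℂ → ℂ := fun τ => Dq f τ - k / 12 * E2 τ * f τ

end

section ModularProperties

open Filter Topology MatrixGroups ModularForm EisensteinSeries
open scoped Manifold

/-! ### Recognising level one forms -/

section LevelOne

open UpperHalfPlane hiding I
open Function SlashInvariantForm ModularFormClass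

variable {f : ℂ → ℂ} {k : ℤ}

theorem slash_coe_eq_self (hT : ∀ τ : ℂ, 0 < τ.im → f (τ + 1) = f τ)
    (hS : ∀ τ : ℂ, 0 < τ.im → f (-1 / τ) = τ ^ k * f τ) (γ : SL(2, ℤ)) :
    (fun z : ℍ ↦ f z) ∣[k] γ = fun z : ℍ ↦ f z := by
  refine slash_action_generators_SL2Z ?_ ?_ γ
  · ext z
    have h := hS z z.im_pos
    rw [SL_slash_apply, UpperHalfPlane.modular_S_smul]
    have hz : (z : ℂ) ^ k ≠ 0 := zpow_ne_zero _ z.ne_zero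
    have : ((-z : ℂ))⁻¹ = -1 / z := by field_simp
    simp [ModularGroup.denom_S, -inv_neg, this, h]
    field_simp
  · ext z
    have h := hT z z.im_pos
    rw [SL_slash_apply, modular_T_smul]
    have : denom ModularGroup.T z = 1 := by
      rw [ModularGroup.denom_apply]
      simp [ModularGroup.T]
    simp [this, ← h, add_comm]

theorem mdifferentiable_coe (hd : DifferentiableOn ℂ f {τ | 0 < τ.im}) :
    MDiff (fun z : ℍ ↦ f z) := by
  rw [UpperHalfPlane.mdifferentiable_iff]
  refine hd.congr fun z hz ↦ ?_
  simp [ofComplex_apply_of_im_pos hz]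

theorem exists_modularForm_eq {a : ℂ} (hd : DifferentiableOn ℂ f {τ | 0 < τ.im})
    (hT : ∀ τ : ℂ, 0 < τ.im → f (τ + 1) = f τ)
    (hS : ∀ τ : ℂ, 0 < τ.im → f (-1 / τ) = τ ^ k * f τ)
    (ha : Tendsto f (comap Complex.im atTop) (𝓝 a)) :
    ∃ F : ModularForm 𝒮ℒ k, ⇑F = fun z : ℍ ↦ f z :=
  ⟨{ toFun := fun z : ℍ ↦ f z
     slash_action_eq' := by
       rintro A ⟨A, rfl⟩
       exact slash_coe_eq_self hT hS A
     holo' := mdifferentiable_coe hd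
     bdd_at_cusps' := fun hc ↦ by
       rw [Subgroup.IsArithmetic.isCusp_iff_isCusp_SL2Z] at hc
       rw [OnePoint.isBoundedAt_iff_forall_SL2Z hc]
       intro γ _
       rw [slash_coe_eq_self hT hS]
       exact (ha.comp tendsto_coe_atImInfty).isBigO_one ℝ }, rfl⟩

theorem exists_cuspForm_eq (hd : DifferentiableOn ℂ f {τ | 0 < τ.im})
    (hT : ∀ τ : ℂ, 0 < τ.im → f (τ + 1) = f τ)
    (hS : ∀ τ : ℂ, 0 < τ.im → f (-1 / τ) = τ ^ k * f τ)
    (ha : Tendsto f (comap Complex.im atTop) (𝓝 0)) :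
    ∃ F : CuspForm 𝒮ℒ k, ⇑F = fun z : ℍ ↦ f z :=
  ⟨{ toFun := fun z : ℍ ↦ f z
     slash_action_eq' := by
       rintro A ⟨A, rfl⟩
       exact slash_coe_eq_self hT hS A
     holo' := mdifferentiable_coe hd
     zero_at_cusps' := fun hc ↦ by
       rw [Subgroup.IsArithmetic.isCusp_iff_isCusp_SL2Z] at hc
       rw [OnePoint.isZeroAt_iff_forall_SL2Z hc]
       intro γ _
       rw [slash_coe_eq_self hT hS]
       exact ha.comp tendsto_coe_atImInfty }, rfl⟩

/-- If the level one forms of weight `k` are spanned by the Eisenstein series, a level one form is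
the multiple of the Eisenstein series given by its value at infinity. -/
theorem eq_mul_eisensteinSeries {k : ℕ} (hk : 3 ≤ k) (hk2 : Even k)
    (hrank : Module.rank ℂ (ModularForm 𝒮ℒ k) = 1) {a : ℂ}
    (hd : DifferentiableOn ℂ f {τ | 0 < τ.im})
    (hT : ∀ τ : ℂ, 0 < τ.im → f (τ + 1) = f τ)
    (hS : ∀ τ : ℂ, 0 < τ.im → f (-1 / τ) = τ ^ (k : ℤ) * f τ)
    (ha : Tendsto f (comap Complex.im atTop) (𝓝 a)) (z : ℍ) :
    f z = a * E hk z := by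
  obtain ⟨F, hF⟩ := exists_modularForm_eq hd hT hS ha
  obtain ⟨c, hc⟩ := (finrank_eq_one_iff_of_nonzero' _ (E_ne_zero hk hk2)).mp
    (Module.rank_eq_one_iff_finrank_eq_one.mp hrank) F
  have hval : valueAtInfty F = a := by
    rw [hF]
    exact (ha.comp tendsto_coe_atImInfty).limUnder_eq
  have h0 : (qExpansion 1 F).coeff 0 = valueAtInfty F :=
    qExpansion_coeff_zero one_pos
      (ModularFormClass.analyticAt_cuspFunction_zero F one_pos one_mem_strictPeriods_SL)
      (by simpa using SlashInvariantFormClass.periodic_comp_ofComplex F one_mem_strictPeriods_SL)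
  have hca : c = a := by
    rw [← hval, ← h0, ← hc]
    simp only [FunLike.coe_smul]
    rw [ModularForm.qExpansion_smul one_pos one_mem_strictPeriods_SL]
    simp [-PowerSeries.coeff_zero_eq_constantCoeff, E_qExpansion_coeff_zero hk hk2]
  rw [← hca]
  calc f z = F z := by rw [hF]
    _ = c * E hk z := by rw [← hc]; rfl

theorem tsum_sigma'_eq (k : ℕ) (τ : ℂ) :
    ∑' n : ℕ+, (ArithmeticFunction.sigma k n : ℂ) *
        Complex.exp (2 * Real.pi * Complex.I * τ) ^ ((n : ℕ) : ℤ) =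
      ∑' n : ℕ, (sigma' k (n + 1) : ℂ) * qexp τ ^ (n + 1) := by
  rw [tsum_pnat_eq_tsum_succ
    (f := fun n : ℕ ↦ (ArithmeticFunction.sigma k n : ℂ) *
        Complex.exp (2 * Real.pi * Complex.I * τ) ^ (n : ℤ))]
  refine tsum_congr fun n ↦ ?_
  rw [zpow_natCast, ArithmeticFunction.sigma_apply]
  rfl

theorem E4_coe (z : ℍ) : E4 z = E (show 3 ≤ 4 by norm_num) z := by
  rw [q_expansion_bernoulli _ ⟨2, rfl⟩, E4, ← tsum_sigma'_eq]
  norm_num [show bernoulli 4 = -1 / 30 by decide +kernel]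

theorem E6_coe (z : ℍ) : E6 z = E (show 3 ≤ 6 by norm_num) z := by
  rw [q_expansion_bernoulli _ ⟨3, rfl⟩, E6, ← tsum_sigma'_eq]
  norm_num [show bernoulli 6 = 1 / 42 by decide +kernel]

end LevelOne

/-! ### Theta constants as specialisations of the two-variable theta function -/

section Theta

theorem jacobiTheta₂_term_add_one (n : ℤ) (z τ : ℂ) :
    jacobiTheta₂_term n z (τ + 1) = jacobiTheta₂_term n (z + 1 / 2) τ := by
  obtain ⟨m, hm⟩ := Int.even_mul_pred_self n
  have hm' : (n : ℂ) * (n - 1) = m + m := by exact_mod_cast congrArg (Int.cast : ℤ → ℂ) hm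
  rw [jacobiTheta₂_term, jacobiTheta₂_term, Complex.exp_eq_exp_iff_exists_int]
  refine ⟨m, ?_⟩
  linear_combination (Real.pi * Complex.I : ℂ) * hm'

theorem jacobiTheta₂_add_one (z τ : ℂ) :
    jacobiTheta₂ z (τ + 1) = jacobiTheta₂ (z + 1 / 2) τ :=
  tsum_congr fun n ↦ jacobiTheta₂_term_add_one n z τ

theorem theta₂_eq (τ : ℂ) :
    θ₂ τ = Complex.exp (Real.pi * Complex.I / 4 * τ) * jacobiTheta₂ (τ / 2) τ := by
  rw [θ₂, jacobiTheta₂, ← tsum_mul_left, ← (Equiv.neg ℤ).tsum_eq]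
  refine tsum_congr fun n ↦ ?_
  rw [qpow, jacobiTheta₂_term, ← Complex.exp_add]
  congr 1
  simp only [Equiv.neg_apply]
  push_cast
  ring

theorem theta₃_eq (τ : ℂ) : θ₃ τ = jacobiTheta₂ 0 τ := by
  refine tsum_congr fun n ↦ ?_
  rw [qpow, jacobiTheta₂_term]
  congr 1
  push_cast
  ring

theorem theta₄_eq (τ : ℂ) : θ₄ τ = jacobiTheta₂ (1 / 2) τ := by
  refine tsum_congr fun n ↦ ?_
  rw [qpow, jacobiTheta₂_term, ← Complex.exp_pi_mul_I, ← Complex.exp_int_mul, ← Complex.exp_add]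
  congr 1
  push_cast
  ring

/-! #### Modular transformations -/

theorem theta₂_add_one (τ : ℂ) : θ₂ (τ + 1) = Complex.exp (Real.pi * Complex.I / 4) * θ₂ τ := by
  rw [theta₂_eq, theta₂_eq, jacobiTheta₂_add_one,
    show (τ + 1) / 2 + 1 / 2 = τ / 2 + 1 by ring, jacobiTheta₂_add_left, ← mul_assoc,
    ← Complex.exp_add]
  ring_nf

theorem theta₃_add_one (τ : ℂ) : θ₃ (τ + 1) = θ₄ τ := by
  rw [theta₃_eq, theta₄_eq, jacobiTheta₂_add_one, zero_add]

theorem theta₄_add_one (τ : ℂ) : θ₄ (τ + 1) = θ₃ τ := by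
  rw [theta₃_eq, theta₄_eq, jacobiTheta₂_add_one, show (1 / 2 + 1 / 2 : ℂ) = 0 + 1 by norm_num,
    jacobiTheta₂_add_left]

theorem cpow_half_pow_eight (τ : ℂ) : ((-Complex.I * τ) ^ (1 / 2 : ℂ)) ^ 8 = τ ^ 4 := by
  rw [← Complex.cpow_nat_mul, show ((8 : ℕ) : ℂ) * (1 / 2) = (4 : ℕ) by norm_num,
    Complex.cpow_natCast, mul_pow, Even.neg_pow (by decide), Complex.I_pow_four, one_mul]

theorem im_neg_one_div_pos {τ : ℂ} (hτ : 0 < τ.im) : 0 < (-1 / τ).im := by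
  simpa [neg_div, Complex.inv_im] using
    div_pos hτ (Complex.normSq_pos.mpr fun h ↦ by simp [h] at hτ)

theorem theta₃_neg_one_div_pow {τ : ℂ} (hτ : 0 < τ.im) : θ₃ (-1 / τ) ^ 8 = τ ^ 4 * θ₃ τ ^ 8 := by
  have h0 : τ ≠ 0 := fun h ↦ by simp [h] at hτ
  rw [theta₃_eq, theta₃_eq, jacobiTheta₂_functional_equation 0 τ, mul_pow, mul_pow, div_pow,
    cpow_half_pow_eight]
  simp
  field_simp

theorem theta₂_neg_one_div_pow {τ : ℂ} (hτ : 0 < τ.im) : θ₂ (-1 / τ) ^ 8 = τ ^ 4 * θ₄ τ ^ 8 := by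
  have h0 : τ ≠ 0 := fun h ↦ by simp [h] at hτ
  have h1 : θ₄ τ = 1 / (-Complex.I * τ) ^ (1 / 2 : ℂ) * θ₂ (-1 / τ) := by
    rw [theta₂_eq, theta₄_eq, jacobiTheta₂_functional_equation (1 / 2) τ, mul_assoc,
      ← jacobiTheta₂_neg_left]
    congr 3
    · field_simp
      norm_num
    · field_simp
  rw [h1, mul_pow, div_pow, cpow_half_pow_eight]
  field_simp

theorem theta₄_neg_one_div_pow {τ : ℂ} (hτ : 0 < τ.im) : θ₄ (-1 / τ) ^ 8 = τ ^ 4 * θ₂ τ ^ 8 := by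
  have h0 : τ ≠ 0 := fun h ↦ by simp [h] at hτ
  have h := theta₂_neg_one_div_pow (im_neg_one_div_pos hτ)
  rw [show -1 / (-1 / τ) = τ by field_simp] at h
  rw [h]
  field_simp

/-! #### Holomorphy and behaviour at infinity -/

theorem differentiableAt_jacobiTheta₂_comp {u : ℂ → ℂ} {τ : ℂ} (hu : DifferentiableAt ℂ u τ)
    (hτ : 0 < τ.im) : DifferentiableAt ℂ (fun t ↦ jacobiTheta₂ (u t) t) τ :=
  (hasFDerivAt_jacobiTheta₂ (u τ) hτ).differentiableAt.comp τ
    (f := fun t ↦ (u t, t)) (hu.prodMk differentiableAt_id)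

theorem differentiableAt_theta₂ {τ : ℂ} (hτ : 0 < τ.im) : DifferentiableAt ℂ θ₂ τ := by
  rw [funext theta₂_eq]
  exact DifferentiableAt.mul (by fun_prop)
    (differentiableAt_jacobiTheta₂_comp (u := fun t ↦ t / 2) (by fun_prop) hτ)

theorem differentiableAt_theta₃ {τ : ℂ} (hτ : 0 < τ.im) : DifferentiableAt ℂ θ₃ τ := by
  rw [funext theta₃_eq]
  exact differentiableAt_jacobiTheta₂_snd 0 hτ

theorem differentiableAt_theta₄ {τ : ℂ} (hτ : 0 < τ.im) : DifferentiableAt ℂ θ₄ τ := by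
  rw [funext theta₄_eq]
  exact differentiableAt_jacobiTheta₂_snd _ hτ

theorem norm_jacobiTheta₂_term_affine (n : ℤ) (a b : ℝ) (τ : ℂ) :
    ‖jacobiTheta₂_term n (a + b * τ) τ‖ = Real.exp (-(Real.pi * (n ^ 2 + 2 * b * n) * τ.im)) := by
  rw [norm_jacobiTheta₂_term]
  congr 1
  simp
  ring

theorem tendsto_jacobiTheta₂_affine {a b : ℝ} (hb : ∀ n : ℤ, 0 ≤ (n : ℝ) ^ 2 + 2 * b * n) :
    Tendsto (fun τ ↦ jacobiTheta₂ (a + b * τ) τ) (comap Complex.im atTop)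
      (𝓝 (∑' n : ℤ, if (n : ℝ) ^ 2 + 2 * b * n = 0 then
        Complex.exp (2 * Real.pi * Complex.I * n * a) else 0)) := by
  refine tendsto_tsum_of_dominated_convergence
    (bound := fun n ↦ ‖jacobiTheta₂_term n (a + b * Complex.I) Complex.I‖)
    ((summable_jacobiTheta₂_term_iff _ Complex.I).mpr (by simp)).norm (fun n ↦ ?_) ?_
  · split_ifs with h
    · refine tendsto_const_nhds.congr fun τ ↦ ?_
      rw [jacobiTheta₂_term]
      have h' : (n : ℂ) ^ 2 + 2 * b * n = 0 := by exact_mod_cast h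
      congr 1
      linear_combination (-(Real.pi * Complex.I * τ) : ℂ) * h'
    · rw [tendsto_zero_iff_norm_tendsto_zero]
      simp_rw [norm_jacobiTheta₂_term_affine]
      refine Real.tendsto_exp_neg_atTop_nhds_zero.comp ?_
      exact tendsto_comap.const_mul_atTop
        (mul_pos Real.pi_pos (lt_of_le_of_ne (hb n) (Ne.symm h)))
  · filter_upwards [preimage_mem_comap (Ici_mem_atTop (1 : ℝ))] with τ hτ n
    rw [norm_jacobiTheta₂_term_affine, norm_jacobiTheta₂_term_affine, Real.exp_le_exp,
      neg_le_neg_iff]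
    exact mul_le_mul_of_nonneg_left (by simpa using hτ) (mul_nonneg Real.pi_pos.le (hb n))

theorem tendsto_jacobiTheta₂_const (a : ℝ) :
    Tendsto (fun τ ↦ jacobiTheta₂ a τ) (comap Complex.im atTop) (𝓝 1) := by
  have h := tendsto_jacobiTheta₂_affine (a := a) (b := 0) fun n ↦ by
    simpa using sq_nonneg (n : ℝ)
  rw [tsum_eq_single 0 fun n hn ↦ by simp [hn]] at h
  simpa using h

theorem tendsto_theta₃ : Tendsto θ₃ (comap Complex.im atTop) (𝓝 1) := by
  simpa [funext theta₃_eq] using tendsto_jacobiTheta₂_const 0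

theorem tendsto_theta₄ : Tendsto θ₄ (comap Complex.im atTop) (𝓝 1) := by
  simpa [funext theta₄_eq] using tendsto_jacobiTheta₂_const (1 / 2)

theorem tendsto_jacobiTheta₂_half :
    Tendsto (fun τ ↦ jacobiTheta₂ (τ / 2) τ) (comap Complex.im atTop) (𝓝 2) := by
  have h := tendsto_jacobiTheta₂_affine (a := 0) (b := 1 / 2) fun n ↦ by
    have : 0 ≤ n * (n + 1) := by
      rcases le_or_gt 0 n with h | h
      · positivity
      · nlinarith
    have : (0 : ℝ) ≤ n * (n + 1) := by exact_mod_cast this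
    linarith
  have hn (n : ℤ) : (n : ℝ) ^ 2 + 2 * (1 / 2) * n = 0 ↔ n = 0 ∨ n = -1 := by
    rw [show (n : ℝ) ^ 2 + 2 * (1 / 2) * n = n * (n + 1) by ring, mul_eq_zero,
      Int.cast_eq_zero, add_eq_zero_iff_eq_neg]
    norm_cast
  simp_rw [hn] at h
  rw [tsum_eq_sum (s := {0, -1}) fun n hn ↦ by simp_all] at h
  norm_num at h
  refine h.congr fun τ ↦ ?_
  ring_nf

theorem Complex.tendsto_deriv_comap_im_atTop {f : ℂ → ℂ} {a : ℂ}
    (hd : ∀ τ : ℂ, 0 < τ.im → DifferentiableAt ℂ f τ)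
    (ha : Tendsto f (comap Complex.im atTop) (𝓝 a)) :
    Tendsto (deriv f) (comap Complex.im atTop) (𝓝 0) := by
  rw [Metric.tendsto_nhds] at ha ⊢
  intro ε hε
  obtain ⟨A, -, hA⟩ := (atTop_basis.comap Complex.im).eventually_iff.mp (ha (ε / 2) (half_pos hε))
  filter_upwards [preimage_mem_comap (Ici_mem_atTop (max A 0 + 2))] with τ hτ
  have hτ : max A 0 + 2 ≤ τ.im := hτ
  have him (z : ℂ) (hz : z ∈ Metric.closedBall τ 1) : max A 0 < z.im := by
    have h1 := (Complex.abs_im_le_norm (z - τ)).trans (mem_closedBall_iff_norm.mp hz)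
    rw [Complex.sub_im] at h1
    linarith [(abs_le.mp h1).1]
  have hle : ‖deriv (fun z ↦ f z - a) τ‖ ≤ ε / 2 / 1 := by
    refine Complex.norm_deriv_le_of_forall_mem_sphere_norm_le one_pos ?_ fun z hz ↦ ?_
    · refine DifferentiableOn.diffContOnCl fun z hz ↦ ?_
      rw [closure_ball _ one_ne_zero] at hz
      exact ((hd z ((le_max_right _ _).trans_lt (him z hz))).sub_const a).differentiableWithinAt
    · have := hA (Set.mem_preimage.mpr <|
        (le_max_left A 0).trans (him z (Metric.sphere_subset_closedBall hz)).le)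
      rw [dist_eq_norm] at this
      exact this.le
  rw [deriv_sub_const] at hle
  rw [dist_zero_right]
  linarith

theorem Complex.tendsto_logDeriv_comap_im_atTop {f : ℂ → ℂ} {a : ℂ} (h0 : a ≠ 0)
    (hd : ∀ τ : ℂ, 0 < τ.im → DifferentiableAt ℂ f τ)
    (ha : Tendsto f (comap Complex.im atTop) (𝓝 a)) :
    Tendsto (logDeriv f) (comap Complex.im atTop) (𝓝 0) := by
  simpa [logDeriv] using (Complex.tendsto_deriv_comap_im_atTop hd ha).div ha h0

/-! #### Nonvanishing -/

theorem exists_theta_prod_pow_eq_mul_discriminant : ∃ c : ℂ, c ≠ 0 ∧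
    ∀ z : UpperHalfPlane, (θ₂ z * θ₃ z * θ₄ z) ^ 8 = c * ModularForm.discriminant z := by
  have hlim : Tendsto (fun τ ↦ jacobiTheta₂ (τ / 2) τ * θ₃ τ * θ₄ τ) (comap Complex.im atTop)
      (𝓝 (2 * 1 * 1)) := (tendsto_jacobiTheta₂_half.mul tendsto_theta₃).mul tendsto_theta₄
  have hexp : Tendsto (fun τ : ℂ ↦ Complex.exp (Real.pi * Complex.I / 4 * τ))
      (comap Complex.im atTop) (𝓝 0) := by
    rw [tendsto_zero_iff_norm_tendsto_zero]
    have : ∀ τ : ℂ, ‖Complex.exp (Real.pi * Complex.I / 4 * τ)‖ =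
        Real.exp (-(Real.pi / 4 * τ.im)) := by
      intro τ
      rw [Complex.norm_exp]
      congr 1
      simp
    simp_rw [this]
    exact Real.tendsto_exp_neg_atTop_nhds_zero.comp
      (tendsto_comap.const_mul_atTop (by positivity))
  have hprod (τ : ℂ) : θ₂ τ * θ₃ τ * θ₄ τ =
      Complex.exp (Real.pi * Complex.I / 4 * τ) * (jacobiTheta₂ (τ / 2) τ * θ₃ τ * θ₄ τ) := by
    rw [theta₂_eq]
    ring
  obtain ⟨F, hF⟩ := exists_cuspForm_eq (f := fun τ ↦ (θ₂ τ * θ₃ τ * θ₄ τ) ^ 8) (k := 12)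
    (fun τ hτ ↦ (((differentiableAt_theta₂ hτ).mul (differentiableAt_theta₃ hτ)).mul
      (differentiableAt_theta₄ hτ)).pow 8 |>.differentiableWithinAt)
    (fun τ hτ ↦ by
      have : Complex.exp (Real.pi * Complex.I / 4) ^ 8 = 1 := by
        rw [← Complex.exp_nat_mul, ← Complex.exp_two_pi_mul_I]
        congr 1
        push_cast
        ring
      rw [theta₂_add_one, theta₃_add_one, theta₄_add_one]
      linear_combination (θ₂ τ * θ₃ τ * θ₄ τ) ^ 8 * this)
    (fun τ hτ ↦ by
      rw [mul_pow, mul_pow, theta₂_neg_one_div_pow hτ, theta₃_neg_one_div_pow hτ,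
        theta₄_neg_one_div_pow hτ]
      norm_cast
      ring)
    (by
      simp_rw [hprod]
      simpa using (hexp.mul hlim).pow 8)
  obtain ⟨c, hc⟩ := CuspForm.exists_smul_discriminant_of_weight_eq_twelve F
  have hval (z : UpperHalfPlane) :
      (θ₂ z * θ₃ z * θ₄ z) ^ 8 = c * ModularForm.discriminant z := by
    rw [← congrFun hF z, ← hc]
    rfl
  refine ⟨c, ?_, hval⟩
  rintro rfl
  have hne := (hlim.eventually_ne (by norm_num : (2 * 1 * 1 : ℂ) ≠ 0)).and
    (preimage_mem_comap (Ioi_mem_atTop (0 : ℝ)))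
  have : (comap Complex.im atTop).NeBot :=
    atTop_neBot.comap_of_surj Complex.im_surjective
  obtain ⟨τ, h1, h2⟩ := hne.exists
  have := hval ⟨τ, h2⟩
  rw [zero_mul] at this
  have := eq_zero_of_pow_eq_zero this
  rw [hprod] at this
  exact (mul_ne_zero (Complex.exp_ne_zero _) h1) this

theorem theta_ne_zero {τ : ℂ} (hτ : 0 < τ.im) : θ₂ τ ≠ 0 ∧ θ₃ τ ≠ 0 ∧ θ₄ τ ≠ 0 := by
  obtain ⟨c, hc, h⟩ := exists_theta_prod_pow_eq_mul_discriminant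
  have h1 : (θ₂ τ * θ₃ τ * θ₄ τ) ^ 8 ≠ 0 := by
    have := h ⟨τ, hτ⟩
    rw [this]
    exact mul_ne_zero hc (ModularForm.discriminant_ne_zero _)
  have h2 := (pow_ne_zero_iff (by norm_num)).mp h1
  exact ⟨left_ne_zero_of_mul (left_ne_zero_of_mul h2),
    right_ne_zero_of_mul (left_ne_zero_of_mul h2), right_ne_zero_of_mul h2⟩

end Theta

/-! ### The logarithmic derivatives of the theta constants -/

section Xi

theorem logDeriv_comp_add_const {f : ℂ → ℂ} (a τ : ℂ) :
    logDeriv (fun t ↦ f (t + a)) τ = logDeriv f (τ + a) := by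
  rw [logDeriv_apply, logDeriv_apply, deriv_comp_add_const]

theorem eventually_im_pos {τ : ℂ} (hτ : 0 < τ.im) : ∀ᶠ t in 𝓝 τ, 0 < t.im :=
  UpperHalfPlane.isOpen_upperHalfPlaneSet.mem_nhds hτ

theorem logDeriv_neg_one_div_of_pow_eight {f g : ℂ → ℂ}
    (hf : ∀ τ : ℂ, 0 < τ.im → DifferentiableAt ℂ f τ)
    (hg : ∀ τ : ℂ, 0 < τ.im → DifferentiableAt ℂ g τ) (hg0 : ∀ τ : ℂ, 0 < τ.im → g τ ≠ 0)
    (hfg : ∀ τ : ℂ, 0 < τ.im → f (-1 / τ) ^ 8 = τ ^ 4 * g τ ^ 8) {τ : ℂ} (hτ : 0 < τ.im) :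
    logDeriv f (-1 / τ) = τ ^ 2 * logDeriv g τ + τ / 2 := by
  have h0 : τ ≠ 0 := fun h ↦ by simp [h] at hτ
  have hS : HasDerivAt (fun t : ℂ ↦ -1 / t) (1 / τ ^ 2) τ := by
    simpa [neg_div] using (hasDerivAt_inv h0).fun_neg
  have hf' := hf _ (im_neg_one_div_pos hτ)
  have hcomp : logDeriv (fun t ↦ f (-1 / t)) τ = logDeriv f (-1 / τ) * (1 / τ ^ 2) := by
    rw [← hS.deriv]
    exact logDeriv_comp (f := f) (g := fun t ↦ -1 / t) hf' hS.differentiableAt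
  have hleft : logDeriv (fun t ↦ f (-1 / t) ^ 8) τ = 8 * (logDeriv f (-1 / τ) * (1 / τ ^ 2)) := by
    rw [logDeriv_fun_pow (f := fun t ↦ f (-1 / t))
      (hf'.comp τ (f := fun t ↦ -1 / t) hS.differentiableAt), hcomp]
    norm_cast
  have hright : logDeriv (fun t ↦ t ^ 4 * g t ^ 8) τ = 4 / τ + 8 * logDeriv g τ := by
    rw [logDeriv_mul (f := fun t ↦ t ^ 4) (g := fun t ↦ g t ^ 8) τ (pow_ne_zero _ h0)
      (pow_ne_zero _ (hg0 τ hτ)) (by fun_prop) ((hg τ hτ).pow 8), logDeriv_pow,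
      logDeriv_fun_pow (hg τ hτ)]
    norm_cast
  have h := (logDeriv_congr_nhds ((eventually_im_pos hτ).mono hfg)).eq_of_nhds
  rw [hleft, hright] at h
  field_simp at h ⊢
  linear_combination h / 4

theorem two_mul_Dq_div_eq (f : ℂ → ℂ) (τ : ℂ) :
    2 * Dq f τ / f τ = logDeriv f τ / (Real.pi * Complex.I) := by
  rw [Dq, logDeriv_apply]
  have : (Real.pi : ℂ) ≠ 0 := Complex.ofReal_ne_zero.mpr Real.pi_ne_zero
  field_simp [Complex.I_ne_zero]

theorem xi₂_eq (τ : ℂ) : ξ₂ τ = logDeriv θ₂ τ / (Real.pi * Complex.I) :=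
  two_mul_Dq_div_eq θ₂ τ

theorem xi₃_eq (τ : ℂ) : ξ₃ τ = logDeriv θ₃ τ / (Real.pi * Complex.I) :=
  two_mul_Dq_div_eq θ₃ τ

theorem xi₄_eq (τ : ℂ) : ξ₄ τ = logDeriv θ₄ τ / (Real.pi * Complex.I) :=
  two_mul_Dq_div_eq θ₄ τ

/-! #### Modular transformations -/

theorem xi₂_add_one (τ : ℂ) : ξ₂ (τ + 1) = ξ₂ τ := by
  rw [xi₂_eq, xi₂_eq, ← logDeriv_comp_add_const, funext theta₂_add_one,
    logDeriv_const_mul _ _ (Complex.exp_ne_zero _)]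

theorem xi₃_add_one (τ : ℂ) : ξ₃ (τ + 1) = ξ₄ τ := by
  rw [xi₃_eq, xi₄_eq, ← logDeriv_comp_add_const, funext theta₃_add_one]

theorem xi₄_add_one (τ : ℂ) : ξ₄ (τ + 1) = ξ₃ τ := by
  rw [xi₃_eq, xi₄_eq, ← logDeriv_comp_add_const, funext theta₄_add_one]

theorem xi₂_neg_one_div {τ : ℂ} (hτ : 0 < τ.im) :
    ξ₂ (-1 / τ) = τ ^ 2 * ξ₄ τ + τ / (2 * Real.pi * Complex.I) := by
  rw [xi₂_eq, xi₄_eq, logDeriv_neg_one_div_of_pow_eight (fun _ ↦ differentiableAt_theta₂)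
    (fun _ ↦ differentiableAt_theta₄) (fun _ h ↦ (theta_ne_zero h).2.2)
    (fun _ ↦ theta₂_neg_one_div_pow) hτ]
  ring

theorem xi₃_neg_one_div {τ : ℂ} (hτ : 0 < τ.im) :
    ξ₃ (-1 / τ) = τ ^ 2 * ξ₃ τ + τ / (2 * Real.pi * Complex.I) := by
  rw [xi₃_eq, xi₃_eq, logDeriv_neg_one_div_of_pow_eight (fun _ ↦ differentiableAt_theta₃)
    (fun _ ↦ differentiableAt_theta₃) (fun _ h ↦ (theta_ne_zero h).2.1)
    (fun _ ↦ theta₃_neg_one_div_pow) hτ]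
  ring

theorem xi₄_neg_one_div {τ : ℂ} (hτ : 0 < τ.im) :
    ξ₄ (-1 / τ) = τ ^ 2 * ξ₂ τ + τ / (2 * Real.pi * Complex.I) := by
  rw [xi₄_eq, xi₂_eq, logDeriv_neg_one_div_of_pow_eight (fun _ ↦ differentiableAt_theta₄)
    (fun _ ↦ differentiableAt_theta₂) (fun _ h ↦ (theta_ne_zero h).1)
    (fun _ ↦ theta₄_neg_one_div_pow) hτ]
  ring

/-! #### Holomorphy and behaviour at infinity -/

theorem differentiableOn_logDeriv {f : ℂ → ℂ}
    (hf : ∀ τ : ℂ, 0 < τ.im → DifferentiableAt ℂ f τ) (hf0 : ∀ τ : ℂ, 0 < τ.im → f τ ≠ 0) :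
    DifferentiableOn ℂ (logDeriv f) {τ | 0 < τ.im} := by
  have hd : DifferentiableOn ℂ f {τ | 0 < τ.im} := fun τ hτ ↦ (hf τ hτ).differentiableWithinAt
  exact (hd.deriv UpperHalfPlane.isOpen_upperHalfPlaneSet).div hd hf0

theorem differentiableOn_xi₂ : DifferentiableOn ℂ ξ₂ {τ | 0 < τ.im} := by
  rw [funext xi₂_eq]
  exact (differentiableOn_logDeriv (fun _ ↦ differentiableAt_theta₂)
    fun _ h ↦ (theta_ne_zero h).1).div_const _

theorem differentiableOn_xi₃ : DifferentiableOn ℂ ξ₃ {τ | 0 < τ.im} := by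
  rw [funext xi₃_eq]
  exact (differentiableOn_logDeriv (fun _ ↦ differentiableAt_theta₃)
    fun _ h ↦ (theta_ne_zero h).2.1).div_const _

theorem differentiableOn_xi₄ : DifferentiableOn ℂ ξ₄ {τ | 0 < τ.im} := by
  rw [funext xi₄_eq]
  exact (differentiableOn_logDeriv (fun _ ↦ differentiableAt_theta₄)
    fun _ h ↦ (theta_ne_zero h).2.2).div_const _

theorem tendsto_xi₃ : Tendsto ξ₃ (comap Complex.im atTop) (𝓝 0) := by
  simpa [funext xi₃_eq] using (Complex.tendsto_logDeriv_comap_im_atTop one_ne_zero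
    (fun _ ↦ differentiableAt_theta₃) tendsto_theta₃).div_const (Real.pi * Complex.I)

theorem tendsto_xi₄ : Tendsto ξ₄ (comap Complex.im atTop) (𝓝 0) := by
  simpa [funext xi₄_eq] using (Complex.tendsto_logDeriv_comap_im_atTop one_ne_zero
    (fun _ ↦ differentiableAt_theta₄) tendsto_theta₄).div_const (Real.pi * Complex.I)

theorem tendsto_xi₂ : Tendsto ξ₂ (comap Complex.im atTop) (𝓝 (1 / 4)) := by
  have hpi : (Real.pi : ℂ) ≠ 0 := Complex.ofReal_ne_zero.mpr Real.pi_ne_zero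
  have hd (τ : ℂ) (hτ : 0 < τ.im) :
      DifferentiableAt ℂ (fun t ↦ jacobiTheta₂ (t / 2) t) τ :=
    differentiableAt_jacobiTheta₂_comp (u := fun t ↦ t / 2) (by fun_prop) hτ
  have h := ((Complex.tendsto_logDeriv_comap_im_atTop two_ne_zero hd
    tendsto_jacobiTheta₂_half).div_const (Real.pi * Complex.I)).const_add (1 / 4)
  rw [zero_div, add_zero] at h
  refine h.congr' ?_
  filter_upwards [preimage_mem_comap (Ioi_mem_atTop (0 : ℝ))] with τ hτ
  have hexp : HasDerivAt (fun t ↦ Complex.exp (Real.pi * Complex.I / 4 * t))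
      (Complex.exp (Real.pi * Complex.I / 4 * τ) * (Real.pi * Complex.I / 4)) τ := by
    simpa using ((hasDerivAt_id τ).const_mul (Real.pi * Complex.I / 4 : ℂ)).cexp
  have h0 : jacobiTheta₂ (τ / 2) τ ≠ 0 := fun h ↦
    (theta_ne_zero hτ).1 (by rw [theta₂_eq, h, mul_zero])
  rw [xi₂_eq, funext theta₂_eq,
    logDeriv_mul (f := fun t ↦ Complex.exp (Real.pi * Complex.I / 4 * t))
      (g := fun t ↦ jacobiTheta₂ (t / 2) t) τ (Complex.exp_ne_zero _) h0 hexp.differentiableAt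
      (hd τ hτ), logDeriv_apply (fun t ↦ Complex.exp _), hexp.deriv,
    mul_div_cancel_left₀ _ (Complex.exp_ne_zero _), add_div]
  congr 1
  field_simp [Complex.I_ne_zero]

theorem xi_quadratic_eq {τ : ℂ} (hτ : 0 < τ.im) :
    ξ₂ τ * ξ₃ τ + ξ₂ τ * ξ₄ τ + ξ₃ τ * ξ₄ τ - (1 / 3) * (ξ₂ τ + ξ₃ τ + ξ₄ τ) ^ 2 =
      -(1 / 48) * E4 τ := by
  have h2 := differentiableOn_xi₂
  have h3 := differentiableOn_xi₃
  have h4 := differentiableOn_xi₄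
  have key := eq_mul_eisensteinSeries (k := 4) (by norm_num) (by decide)
    levelOne_weight_four_rank_one (a := -(1 / 48))
    (f := fun τ ↦ ξ₂ τ * ξ₃ τ + ξ₂ τ * ξ₄ τ + ξ₃ τ * ξ₄ τ - (1 / 3) * (ξ₂ τ + ξ₃ τ + ξ₄ τ) ^ 2)
    (by fun_prop)
    (fun τ _ ↦ by
      rw [xi₂_add_one, xi₃_add_one, xi₄_add_one]
      ring)
    (fun τ hτ ↦ by
      rw [xi₂_neg_one_div hτ, xi₃_neg_one_div hτ, xi₄_neg_one_div hτ]
      norm_cast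
      ring)
    (by
      have := (((tendsto_xi₂.mul tendsto_xi₃).add (tendsto_xi₂.mul tendsto_xi₄)).add
        (tendsto_xi₃.mul tendsto_xi₄)).sub
        ((((tendsto_xi₂.add tendsto_xi₃).add tendsto_xi₄).pow 2).const_mul (1 / 3))
      norm_num at this ⊢
      exact this)
    ⟨τ, hτ⟩
  rw [← E4_coe] at key
  exact key

theorem xi_cubic_eq {τ : ℂ} (hτ : 0 < τ.im) :
    ξ₂ τ * ξ₃ τ * ξ₄ τ -
        (1 / 3) * (ξ₂ τ + ξ₃ τ + ξ₄ τ) * (ξ₂ τ * ξ₃ τ + ξ₂ τ * ξ₄ τ + ξ₃ τ * ξ₄ τ) +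
        (2 / 27) * (ξ₂ τ + ξ₃ τ + ξ₄ τ) ^ 3 = (1 / 864) * E6 τ := by
  have h2 := differentiableOn_xi₂
  have h3 := differentiableOn_xi₃
  have h4 := differentiableOn_xi₄
  have key := eq_mul_eisensteinSeries (k := 6) (by norm_num) (by decide)
    levelOne_weight_six_rank_one (a := 1 / 864)
    (f := fun τ ↦ ξ₂ τ * ξ₃ τ * ξ₄ τ -
        (1 / 3) * (ξ₂ τ + ξ₃ τ + ξ₄ τ) * (ξ₂ τ * ξ₃ τ + ξ₂ τ * ξ₄ τ + ξ₃ τ * ξ₄ τ) +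
        (2 / 27) * (ξ₂ τ + ξ₃ τ + ξ₄ τ) ^ 3)
    (by fun_prop)
    (fun τ _ ↦ by
      rw [xi₂_add_one, xi₃_add_one, xi₄_add_one]
      ring)
    (fun τ hτ ↦ by
      rw [xi₂_neg_one_div hτ, xi₃_neg_one_div hτ, xi₄_neg_one_div hτ]
      norm_cast
      ring)
    (by
      have hs := (tendsto_xi₂.add tendsto_xi₃).add tendsto_xi₄
      have := (((tendsto_xi₂.mul tendsto_xi₃).mul tendsto_xi₄).sub
        ((hs.const_mul (1 / 3)).mul (((tendsto_xi₂.mul tendsto_xi₃).add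
          (tendsto_xi₂.mul tendsto_xi₄)).add (tendsto_xi₃.mul tendsto_xi₄)))).add
        ((hs.pow 3).const_mul (2 / 27))
      norm_num at this ⊢
      exact this)
    ⟨τ, hτ⟩
  rw [← E6_coe] at key
  exact key

end Xi

end ModularProperties

/-- The elementary symmetric functions of `ξ₂, ξ₃, ξ₄` express `E₄` and `E₆`:
`p₂ - p₁²/3 = -E₄/48` and `p₃ - p₁p₂/3 + 2p₁³/27 = E₆/864`. -/
theorem symmetric_functions_of_xi (τ : ℂ) (hτ : 0 < τ.im) :
    (ξ₂ τ * ξ₃ τ + ξ₂ τ * ξ₄ τ + ξ₃ τ * ξ₄ τ) -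
        (1/3) * (ξ₂ τ + ξ₃ τ + ξ₄ τ) ^ 2 = -(1/48) * E4 τ ∧
    ξ₂ τ * ξ₃ τ * ξ₄ τ -
        (1/3) * (ξ₂ τ + ξ₃ τ + ξ₄ τ) * (ξ₂ τ * ξ₃ τ + ξ₂ τ * ξ₄ τ + ξ₃ τ * ξ₄ τ) +
        (2/27) * (ξ₂ τ + ξ₃ τ + ξ₄ τ) ^ 3 = (1/864) * E6 τ := by
  exact ⟨xi_quadratic_eq hτ, xi_cubic_eq hτ⟩
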